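/- Let P_{i+1} be obtained from a CHC set P_i by constraint replacement (rule R4): P_{i+1} = (P_i \ {H ← c_1, G, …, H ← c_k, G}) ∪ {H ← d_1, G, …, H ← d_m, G}, where D ⊨ ∀(∃Y1…∃Yr (c_1 ∨ … ∨ c_k) ↔ ∃Z1…∃Zs (d_1 ∨ … ∨ d_m)) and {Y1,…,Yr} (resp. {Z1,…,Zs}) are the free variables of c_1 ∨ … ∨ c_k (resp. d_1 ∨ … ∨ d_m) not occurring in vars(H,G). Then a symbolic interpretation Σ is an A-definable model of P_i if and only if Σ is an A-definable model of P_{i+1}. -/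

import Mathlib

namespace CHC

variable {V U PS : Type}

/-- Variable assignments into the universe `U` of the canonical interpretation `D`. -/
abbrev Assign (V U : Type) : Type := V → U

/-- Semantic formulas: a formula (in particular a constraint of `C`) is identified with
the set of assignments satisfying it in the canonical interpretation `D`. -/
abbrev Form (V U : Type) : Type := Assign V U → Prop

/-- `φ` depends only on the variables in `S` (a semantic rendering of
"the free variables of `φ` are contained in `S`"). -/
def DependsOn (φ : Form V U) (S : Set V) : Prop :=
  ∀ α β : Assign V U, (∀ x ∈ S, α x = β x) → (φ α ↔ φ β)

/-- An atom `p(X1,…,Xm)` with distinct variables `X1,…,Xm`. -/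
structure Atom (V PS : Type) where
  pred : PS
  args : List V
  nodup : args.Nodup

def Atom.varset (A : Atom V PS) : Set V := {x | x ∈ A.args}

def bodyVars (G : List (Atom V PS)) : Set V := {x | ∃ A ∈ G, x ∈ A.args}

/-- A constrained Horn clause `head ← constr, body`; `head = none` encodes `false`.
`cvars` records the (syntactic) variables of the constraint. -/
structure Clause (V U PS : Type) where
  head : Option (Atom V PS)
  constr : Form V U
  cvars : Set V
  hdep : DependsOn constr cvars
  body : List (Atom V PS)

def headVars : Option (Atom V PS) → Set V
  | none => ∅
  | some A => A.varset

def Clause.vars (C : Clause V U PS) : Set V :=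
  C.cvars ∪ headVars C.head ∪ bodyVars C.body

def Clause.headPred (C : Clause V U PS) : Option PS := C.head.map Atom.pred

def Clause.preds (C : Clause V U PS) : Set PS :=
  {p | (∃ A, C.head = some A ∧ A.pred = p) ∨ (∃ A ∈ C.body, A.pred = p)}

/-- The predicate symbols occurring in a set of clauses. -/
def predsOf (P : Set (Clause V U PS)) : Set PS := {p | ∃ C ∈ P, p ∈ C.preds}

/-- A `D`-interpretation: the symbols outside `Pred_u` are already interpreted by the
canonical interpretation (baked into semantic formulas), so only the user-defined
predicates need an interpretation. -/
abbrev Interp (U PS : Type) : Type := PS → List U → Prop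

def Atom.sat (A : Atom V PS) (I : Interp U PS) (α : Assign V U) : Prop :=
  I A.pred (A.args.map α)

def headSat (I : Interp U PS) : Option (Atom V PS) → Assign V U → Prop
  | none, _ => False
  | some A, α => A.sat I α

def Clause.holds (C : Clause V U PS) (I : Interp U PS) : Prop :=
  ∀ α : Assign V U, C.constr α → (∀ A ∈ C.body, A.sat I α) → headSat I C.head α

/-- `I` is a `D`-model of the set `P` of clauses. -/
def IsModel (I : Interp U PS) (P : Set (Clause V U PS)) : Prop :=
  ∀ C ∈ P, C.holds I

/-- `P` is `D`-satisfiable. -/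
def Satisfiable (P : Set (Clause V U PS)) : Prop :=
  ∃ I : Interp U PS, IsModel I P

/-- The least `D`-model of a set of definite clauses. -/
def lm (P : Set (Clause V U PS)) : Interp U PS :=
  fun p as => ∀ I : Interp U PS, IsModel I P → I p as

/-- Renaming of an atom by a bijection on variables. -/
def Atom.rename (σ : V ≃ V) (A : Atom V PS) : Atom V PS :=
  ⟨A.pred, A.args.map σ, A.nodup.map σ.injective⟩

/-- Renaming of a clause by a bijection on variables. -/
def Clause.rename (σ : V ≃ V) (C : Clause V U PS) : Clause V U PS where
  head := C.head.map (Atom.rename σ)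
  constr := fun α => C.constr (α ∘ σ)
  cvars := σ '' C.cvars
  hdep := by
    intro α β h
    exact C.hdep (α ∘ σ) (β ∘ σ) (fun x hx => h (σ x) ⟨x, hx, rfl⟩)
  body := C.body.map (Atom.rename σ)

/-- Existential quantification of the variables in `Xs`. -/
def exQ (Xs : Set V) (φ : Form V U) : Form V U :=
  fun α => ∃ β : Assign V U, (∀ x ∉ Xs, β x = α x) ∧ φ β

/-- The class `A^{∃∨}` of existentially quantified finite disjunctions of formulas of `𝒜`. -/
def AexOr (𝒜 : Set (Form V U)) : Set (Form V U) :=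
  { ψ | ∃ (Xs : Finset V) (φs : List (Form V U)),
      φs ≠ [] ∧ (∀ φ ∈ φs, φ ∈ 𝒜) ∧ ψ = exQ (↑Xs) (fun α => ∃ φ ∈ φs, φ α) }

/-- `𝒜` contains `true`, `false` and equalities between (variable) terms,
and is closed under conjunction. -/
def GoodConstraintSet (𝒜 : Set (Form V U)) : Prop :=
  (fun _ => True) ∈ 𝒜 ∧ (fun _ => False) ∈ 𝒜 ∧
  (∀ x y : V, (fun α => α x = α y) ∈ 𝒜) ∧
  (∀ φ ψ : Form V U, φ ∈ 𝒜 → ψ ∈ 𝒜 → (fun α => φ α ∧ ψ α) ∈ 𝒜)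

/-- A symbolic interpretation: a function from atoms to `A^{∃∨}` whose value on an atom
depends only on the variables of the atom and which commutes with renamings. -/
structure SymbInterp (V U PS : Type) (𝒜 : Set (Form V U)) where
  val : Atom V PS → Form V U
  mem : ∀ A : Atom V PS, val A ∈ AexOr 𝒜
  fvars : ∀ A : Atom V PS, DependsOn (val A) A.varset
  rename_eq : ∀ (A : Atom V PS) (σ : V ≃ V),
    val (Atom.rename σ A) = fun α => val A (α ∘ σ)

variable {𝒜 𝒞 : Set (Form V U)}

/-- Extension of a symbolic interpretation to conjunctions of atoms. -/
def SymbInterp.bodySat (Sg : SymbInterp V U PS 𝒜) (G : List (Atom V PS))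
    (α : Assign V U) : Prop :=
  ∀ A ∈ G, Sg.val A α

/-- Extension of a symbolic interpretation to heads, with `Σ(false) = false`. -/
def SymbInterp.headSat (Sg : SymbInterp V U PS 𝒜) :
    Option (Atom V PS) → Assign V U → Prop
  | none, _ => False
  | some A, α => Sg.val A α

/-- `Sg` is an `𝒜`-definable model of `P`. -/
def SymbInterp.isAModel (Sg : SymbInterp V U PS 𝒜) (P : Set (Clause V U PS)) : Prop :=
  ∀ C ∈ P, ∀ α : Assign V U, C.constr α → Sg.bodySat C.body α → Sg.headSat C.head α

/-- `Sg` is tight on `S`: for every clause `A ← c, G` of `S`,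
`Σ(A)` is equivalent to `∃X̄ (c ∧ Σ(G))`, where the variables of `A` stay free. -/
def SymbInterp.tightOn (Sg : SymbInterp V U PS 𝒜) (S : Set (Clause V U PS)) : Prop :=
  ∀ C ∈ S, ∀ A : Atom V PS, C.head = some A →
    ∀ α : Assign V U,
      Sg.val A α ↔
        ∃ β : Assign V U, (∀ x ∈ A.varset, β x = α x) ∧ C.constr β ∧ Sg.bodySat C.body β

/-! ### The transformation rules R1–R4 -/

/-- Rule R1 (Definition): add a clause `newp(X1,…,Xk) ← c, G` where `newp` is a fresh
predicate, `c ∈ 𝒜`, `G` is a nonempty conjunction of atoms whose predicates occur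
in `P0`, and `X1,…,Xk` are distinct variables occurring free in `(c, G)`. -/
def R1 (𝒜 : Set (Form V U)) (P0 P Defs P' Defs' : Set (Clause V U PS)) : Prop :=
  ∃ (D : Clause V U PS) (A : Atom V PS),
    D.head = some A ∧ D.constr ∈ 𝒜 ∧ D.body ≠ [] ∧
    (∀ B ∈ D.body, B.pred ∈ predsOf P0) ∧
    A.pred ∉ predsOf (P0 ∪ P ∪ Defs) ∧
    A.varset ⊆ D.cvars ∪ bodyVars D.body ∧
    P' = P ∪ {D} ∧ Defs' = Defs ∪ {D}

/-- Rule R2 (Unfolding) of the atom `A` in clause `C ∈ P`, yielding `P'`: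
`C` is `H ← c, G1, p(X̄), G2` and it is replaced by the clauses
`H ← c, c_j, G1, B_j, G2`, one for each (renamed-apart) clause
`p(X̄) ← c_j, B_j` of `P` whose head predicate is `p`. -/
def R2At (C : Clause V U PS) (A : Atom V PS) (P P' : Set (Clause V U PS)) : Prop :=
  C ∈ P ∧
  ∃ (G1 G2 : List (Atom V PS)) (ren : Clause V U PS → Clause V U PS),
    C.body = G1 ++ A :: G2 ∧
    (∀ D ∈ P, D.headPred = some A.pred →
       (∃ σ : V ≃ V, ren D = D.rename σ) ∧
       (∃ K : Atom V PS, (ren D).head = some K ∧ K.pred = A.pred ∧ K.args = A.args) ∧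
       (ren D).vars ∩ C.vars ⊆ A.varset) ∧
    P' = (P \ {C}) ∪
      { E | ∃ D ∈ P, D.headPred = some A.pred ∧
            E.head = C.head ∧
            E.body = G1 ++ (ren D).body ++ G2 ∧
            ∀ α : Assign V U, E.constr α ↔ (C.constr α ∧ (ren D).constr α) }

/-- A self-unfolding: the unfolded atom has the same predicate as the head. -/
def SelfUnfolding (C : Clause V U PS) (A : Atom V PS) : Prop :=
  ∃ K : Atom V PS, C.head = some K ∧ K.pred = A.pred

/-- Rule R3 (Folding) of clause `C ∈ P` using (a variant of) the definition `D0 ∈ Defs`. -/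
def R3At (𝒞 : Set (Form V U)) (C D0 : Clause V U PS)
    (P Defs P' : Set (Clause V U PS)) : Prop :=
  C ∈ P ∧ D0 ∈ Defs ∧
  ∃ (σ : V ≃ V) (K : Atom V PS) (θ : V → V) (E : Clause V U PS)
    (G1 Q G2 : List (Atom V PS)),
    let D := D0.rename σ
    D.vars ∩ C.vars = ∅ ∧
    D.head = some K ∧
    C.body = G1 ++ Q ++ G2 ∧
    Q ≠ [] ∧
    -- (i) Q = Bθ
    Q.length = D.body.length ∧
    (∀ (i : ℕ) (h1 : i < Q.length) (h2 : i < D.body.length),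
       (Q.get ⟨i, h1⟩).pred = (D.body.get ⟨i, h2⟩).pred ∧
       (Q.get ⟨i, h1⟩).args = (D.body.get ⟨i, h2⟩).args.map θ) ∧
    -- `e` (the constraint of the folded clause `E`) is a constraint of `𝒞`
    E.constr ∈ 𝒞 ∧
    -- (ii) D ⊨ ∀ (c ↔ (e ∧ dθ))
    (∀ α : Assign V U, C.constr α ↔ (E.constr α ∧ D.constr (α ∘ θ))) ∧
    -- (iii)
    (∀ X ∈ (D.cvars ∪ bodyVars D.body) \ K.varset,
       (θ X ∉ C.cvars ∪ headVars C.head ∪ bodyVars G1 ∪ bodyVars G2) ∧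
       ∀ Y ∈ D.cvars ∪ bodyVars D.body, Y ≠ X → θ X ≠ θ Y) ∧
    E.head = C.head ∧
    (∃ hK : (K.args.map θ).Nodup,
       E.body = G1 ++ (⟨K.pred, K.args.map θ, hK⟩ : Atom V PS) :: G2) ∧
    P' = (P \ {C}) ∪ {E}

/-- Rule R4 (Constraint replacement). -/
def R4 (𝒞 : Set (Form V U)) (P P' : Set (Clause V U PS)) : Prop :=
  ∃ (hd : Option (Atom V PS)) (G : List (Atom V PS)) (cs ds : List (Clause V U PS)),
    cs ≠ [] ∧
    (∀ E ∈ cs, E ∈ P ∧ E.head = hd ∧ E.body = G) ∧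
    (∀ E ∈ ds, E.head = hd ∧ E.body = G ∧ E.constr ∈ 𝒞) ∧
    (∀ α : Assign V U,
       (∃ β : Assign V U, (∀ x ∈ headVars hd ∪ bodyVars G, β x = α x) ∧
          ∃ E ∈ cs, E.constr β) ↔
       (∃ β : Assign V U, (∀ x ∈ headVars hd ∪ bodyVars G, β x = α x) ∧
          ∃ E ∈ ds, E.constr β)) ∧
    P' = (P \ {E | E ∈ cs}) ∪ {E | E ∈ ds}

/-- One step of a transformation sequence: `(P, Defs)` is transformed into
`(P', Defs')` by one of the rules R1–R4. -/
def Step (𝒞 𝒜 : Set (Form V U)) (P0 P Defs P' Defs' : Set (Clause V U PS)) : Prop :=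
  R1 𝒜 P0 P Defs P' Defs'
  ∨ (Defs' = Defs ∧ ∃ (C : Clause V U PS) (A : Atom V PS), R2At C A P P')
  ∨ (Defs' = Defs ∧ ∃ C D0 : Clause V U PS, R3At 𝒞 C D0 P Defs P')
  ∨ (Defs' = Defs ∧ R4 𝒞 P P')

/-- A transformation sequence `P0, P1, …, Pn` over `𝒞` (with `𝒜 ⊆ 𝒞` the constraints
allowed in definitions), together with the sets `Defs_i` of introduced definitions. -/
def TransfSeq (𝒞 𝒜 : Set (Form V U)) (n : ℕ) (Ps Ds : ℕ → Set (Clause V U PS)) : Prop :=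
  Ds 0 = ∅ ∧ ∀ i < n, Step 𝒞 𝒜 (Ps 0) (Ps i) (Ds i) (Ps (i + 1)) (Ds (i + 1))

/-- Every definition of `Defs_n` is unfolded during the construction of the sequence. -/
def EveryDefUnfolded (n : ℕ) (Ps Ds : ℕ → Set (Clause V U PS)) : Prop :=
  ∀ D ∈ Ds n, ∃ i < n, ∃ A : Atom V PS, R2At D A (Ps i) (Ps (i + 1))

/-- Heads depend only on their variables. -/
theorem SymbInterp.headSat_congr {V U PS : Type} {𝒜 : Set (Form V U)}
    (Sg : SymbInterp V U PS 𝒜) (hd : Option (Atom V PS)) (α β : Assign V U)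
    (h : ∀ x ∈ headVars hd, β x = α x) (hs : Sg.headSat hd β) : Sg.headSat hd α := by
  cases hd with
  | none => exact hs
  | some A => exact (Sg.fvars A β α h).1 hs

/-- Validity of a family of clauses with common head and body transfers along
implication of the existentially quantified constraints. -/
theorem SymbInterp.transfer {V U PS : Type} {𝒜 : Set (Form V U)}
    (Sg : SymbInterp V U PS 𝒜) (hd : Option (Atom V PS)) (G : List (Atom V PS))
    (cs ds : List (Clause V U PS))
    (hc : ∀ E ∈ cs, E.head = hd ∧ E.body = G)
    (hds : ∀ E ∈ ds, E.head = hd ∧ E.body = G)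
    (himp : ∀ α : Assign V U,
       (∃ β : Assign V U, (∀ x ∈ headVars hd ∪ bodyVars G, β x = α x) ∧
          ∃ E ∈ ds, E.constr β) →
       (∃ β : Assign V U, (∀ x ∈ headVars hd ∪ bodyVars G, β x = α x) ∧
          ∃ E ∈ cs, E.constr β))
    (hm : ∀ C ∈ cs, ∀ α : Assign V U, C.constr α → Sg.bodySat C.body α →
      Sg.headSat C.head α) :
    ∀ C ∈ ds, ∀ α : Assign V U, C.constr α → Sg.bodySat C.body α →
      Sg.headSat C.head α := by
  intro C hC α hα hb
  obtain ⟨h1, h2⟩ := hds C hC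
  rw [h2] at hb
  rw [h1]
  obtain ⟨β, hβ, E, hE, hEβ⟩ := himp α ⟨α, fun _ _ => rfl, C, hC, hα⟩
  obtain ⟨e1, e2⟩ := hc E hE
  have hh := hm E hE β hEβ
  rw [e1, e2] at hh
  refine Sg.headSat_congr hd α β (fun x hx => hβ x (Or.inl hx)) (hh ?_)
  intro A hA
  exact (Sg.fvars A β α (fun x hx => hβ x (Or.inr ⟨A, hA, hx⟩))).2 (hb A hA)

/-- Constraint replacement (rule R4) preserves and reflects `𝒜`-definable models:
a symbolic interpretation `Sg` is an `𝒜`-definable model of `P` iff it is an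
`𝒜`-definable model of `P'`. -/
theorem constraint_replacement_A_model_iff
    {V U PS : Type} (𝒞 𝒜 : Set (Form V U)) (P P' : Set (Clause V U PS))
    (h : R4 𝒞 P P') (Sg : SymbInterp V U PS 𝒜) :
    Sg.isAModel P ↔ Sg.isAModel P' := by
  obtain ⟨hd, G, cs, ds, -, hc, hds, hiff, rfl⟩ := h
  have hc' : ∀ E ∈ cs, E.head = hd ∧ E.body = G := fun E hE => (hc E hE).2
  have hds' : ∀ E ∈ ds, E.head = hd ∧ E.body = G :=
    fun E hE => ⟨(hds E hE).1, (hds E hE).2.1⟩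
  constructor
  · intro hm C hC
    rcases hC with hC | hC
    · exact hm C hC.1
    · exact Sg.transfer hd G cs ds hc' hds' (fun α => (hiff α).2)
        (fun E hE => hm E (hc E hE).1) C hC
  · intro hm C hC
    by_cases hCc : C ∈ cs
    · exact Sg.transfer hd G ds cs hds' hc' (fun α => (hiff α).1)
        (fun E hE => hm E (Or.inr hE)) C hCc
    · exact hm C (Or.inl ⟨hC, hCc⟩)

end CHC
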